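/- arXiv:2605.02040 — 4 statements merged into one kernel-verified Lean document; each statement's English description precedes it below -/
import Mathlib

section
/- Let T > 0, σ > 0, and x, k ∈ ℝ. If X is a real Gaussian random variable with mean x and variance σ²T (i.e. its law is the Gaussian measure gaussianReal x (σ²T)), then E[(X − k)⁺] = Bac(T, x, k, σ) = (x − k)·N(d) + σ√T·φ(d), where d = (x − k)/(σ√T). -/
open MeasureTheory ProbabilityTheory Real NNReal

/-- Standard normal cumulative distribution function. -/
noncomputable def normalCDF (z : ℝ) : ℝ :=
  ∫ t in Set.Iic z, Real.exp (-t ^ 2 / 2) / Real.sqrt (2 * Real.pi)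

/-- Standard normal probability density function. -/
noncomputable def normalPDF (z : ℝ) : ℝ :=
  Real.exp (-z ^ 2 / 2) / Real.sqrt (2 * Real.pi)

/-- Bachelier moneyness. -/
noncomputable def dBac (T x k σ : ℝ) : ℝ := (x - k) / (σ * Real.sqrt T)

/-- Bachelier call price. -/
noncomputable def Bac (T x k σ : ℝ) : ℝ :=
  (x - k) * normalCDF (dBac T x k σ) + σ * Real.sqrt T * normalPDF (dBac T x k σ)

lemma hasDerivAt_normalPDF (z : ℝ) : HasDerivAt normalPDF (-z * normalPDF z) z := by
  have h : HasDerivAt (fun y : ℝ => -y ^ 2 / 2) (-z) z := by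
    refine (((hasDerivAt_id' z).fun_pow 2).fun_neg.div_const 2).congr_deriv ?_
    simp
    ring
  refine (h.exp.div_const (√(2 * π))).congr_deriv ?_
  rw [normalPDF]
  ring

lemma integrable_normalPDF : Integrable normalPDF := by
  refine ((integrable_exp_neg_mul_sq (b := 1 / 2) (by norm_num)).div_const (√(2 * π))).congr
    (.of_forall fun y => ?_)
  simp only [normalPDF]
  ring_nf

lemma integrable_neg_mul_normalPDF : Integrable fun y => -y * normalPDF y := by
  refine ((integrable_mul_exp_neg_mul_sq (b := 1 / 2) (by norm_num)).div_const
    (√(2 * π))).neg.congr (.of_forall fun y => ?_)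
  simp only [normalPDF, Pi.neg_apply]
  ring_nf

lemma tendsto_normalPDF_atBot : Filter.Tendsto normalPDF Filter.atBot (nhds 0) := by
  have h : Filter.Tendsto (fun y : ℝ => y ^ 2 / 2) Filter.atBot Filter.atTop :=
    (Filter.Tendsto.atTop_div_const two_pos
      ((Filter.tendsto_pow_atTop two_ne_zero).comp Filter.tendsto_abs_atBot_atTop)).congr
      fun y => by simp
  have h' := (tendsto_exp_neg_atTop_nhds_zero.comp h).div_const (√(2 * π))
  rw [zero_div] at h'
  exact h'.congr fun y => by simp [normalPDF, neg_div]

lemma integral_Iic_neg_mul_normalPDF (d : ℝ) :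
    ∫ y in Set.Iic d, -y * normalPDF y = normalPDF d := by
  rw [integral_Iic_of_hasDerivAt_of_tendsto' (fun y _ => hasDerivAt_normalPDF y)
    integrable_neg_mul_normalPDF.integrableOn tendsto_normalPDF_atBot, sub_zero]

/-- The expected positive part `E[(d - Y)⁺]` for a standard Gaussian `Y`. -/
lemma integral_max_sub_gaussianReal (d : ℝ) :
    ∫ y, max (d - y) 0 ∂gaussianReal 0 1 = d * normalCDF d + normalPDF d := by
  have h : ∀ y, gaussianPDFReal 0 1 y • max (d - y) 0 =
      (Set.Iic d).indicator (fun y => d * normalPDF y + -y * normalPDF y) y := by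
    intro y
    have hp : gaussianPDFReal 0 1 y = normalPDF y := by
      simp [gaussianPDFReal, normalPDF, div_eq_inv_mul]
    rw [hp, smul_eq_mul]
    by_cases hy : y ≤ d
    · rw [Set.indicator_of_mem (Set.mem_Iic.mpr hy), max_eq_left (by linarith)]
      ring
    · rw [Set.indicator_of_notMem (by simpa using hy), max_eq_right (by linarith), mul_zero]
  rw [integral_gaussianReal_eq_integral_smul one_ne_zero]
  simp_rw [h]
  rw [integral_indicator measurableSet_Iic,
    integral_add (integrable_normalPDF.const_mul d).integrableOn
      integrable_neg_mul_normalPDF.integrableOn,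
    integral_const_mul, integral_Iic_neg_mul_normalPDF]
  rfl

lemma gaussianReal_eq_map_sub_mul (x s : ℝ) (v : ℝ≥0) (hv : (v : ℝ) = s ^ 2) :
    gaussianReal x v = (gaussianReal 0 1).map fun y => x - s * y := by
  have h := gaussianReal_map_const_sub (μ := s * 0) (v := .mk (s ^ 2) (sq_nonneg s) * 1) x
  rw [← gaussianReal_map_const_mul, Measure.map_map (by fun_prop) (by fun_prop)] at h
  have hv' : (NNReal.mk (s ^ 2) (sq_nonneg s) * 1 : ℝ≥0) = v := by
    ext
    simp [hv]
  rw [hv', mul_zero, sub_zero] at h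
  exact h.symm

/-- If `X` is Gaussian with mean `x` and variance `σ² T`, then
`E[(X − k)⁺] = Bac(T, x, k, σ)`. -/
theorem bachelier_price_eq_gaussian_expectation
    {Ω : Type*} [MeasurableSpace Ω] (P : Measure Ω) [IsProbabilityMeasure P]
    (T σ x k : ℝ) (hT : 0 < T) (hσ : 0 < σ)
    (X : Ω → ℝ) (hX : Measurable X)
    (v : ℝ≥0) (hv : (v : ℝ) = σ ^ 2 * T)
    (hlaw : P.map X = gaussianReal x v) :
    ∫ ω, max (X ω - k) 0 ∂P = Bac T x k σ := by
  have hs : 0 < σ * √T := mul_pos hσ (sqrt_pos.mpr hT)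
  have hvs : (v : ℝ) = (σ * √T) ^ 2 := by rw [hv, mul_pow, sq_sqrt hT.le]
  have hd : x - k = σ * √T * dBac T x k σ := by
    rw [dBac, mul_div_cancel₀ _ hs.ne']
  have hmax : ∀ y, max (x - σ * √T * y - k) 0 = σ * √T * max (dBac T x k σ - y) 0 := by
    intro y
    rw [mul_max_of_nonneg _ _ hs.le, mul_zero, mul_sub, ← hd]
    ring_nf
  rw [← integral_map (φ := X) (f := fun y => max (y - k) 0) hX.aemeasurable (by fun_prop), hlaw,
    gaussianReal_eq_map_sub_mul x _ v hvs, integral_map (by fun_prop) (by fun_prop)]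
  simp_rw [hmax]
  rw [integral_const_mul, integral_max_sub_gaussianReal, Bac, hd]
  ring
end

section
/- For every T > 0, σ > 0 and x, k ∈ ℝ, the Bachelier price solves the Bachelier (heat) equation in the time-to-maturity variable: ∂Bac/∂T (T,x,k,σ) = (1/2)·σ²·∂²Bac/∂x² (T,x,k,σ). Equivalently, the Bachelier differential operator L_Bac(σ) = −∂/∂T + (1/2)σ² ∂²/∂x² annihilates Bac(·, ·, k, σ). -/
open MeasureTheory ProbabilityTheory Real NNReal

lemma continuous_normalPDF : Continuous normalPDF := by
  unfold normalPDF
  fun_prop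

lemma hasDerivAt_normalCDF (z : ℝ) : HasDerivAt normalCDF (normalPDF z) z := by
  have h : normalCDF = fun u => normalCDF 0 + ∫ t in (0 : ℝ)..u, normalPDF t := by
    funext u
    have := intervalIntegral.integral_Iic_sub_Iic (a := 0) (b := u)
      integrable_normalPDF.integrableOn integrable_normalPDF.integrableOn
    rw [← this]
    simp only [normalCDF, normalPDF]
    ring
  rw [h]
  exact (intervalIntegral.integral_hasDerivAt_right
    (continuous_normalPDF.intervalIntegrable _ _)
    (continuous_normalPDF.stronglyMeasurableAtFilter _ _)
    continuous_normalPDF.continuousAt).const_add _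

/-- Chain rule for `y N(y / s) + s φ(y / s)`: its partial derivatives are `N(y / s)` in `y` and
`φ(y / s)` in `s`. -/
lemma hasDerivAt_mul_normalCDF_add_mul_normalPDF {y s : ℝ → ℝ} {y' s' a : ℝ}
    (hy : HasDerivAt y y' a) (hs : HasDerivAt s s' a) (h0 : s a ≠ 0) :
    HasDerivAt (fun u => y u * normalCDF (y u / s u) + s u * normalPDF (y u / s u))
      (y' * normalCDF (y a / s a) + s' * normalPDF (y a / s a)) a := by
  have hd := hy.fun_div hs h0
  refine ((hy.fun_mul ((hasDerivAt_normalCDF _).comp a hd)).fun_add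
    (hs.fun_mul ((hasDerivAt_normalPDF _).comp a hd))).congr_deriv ?_
  simp only [Function.comp_apply]
  field_simp
  ring

lemma hasDerivAt_Bac_time {T σ : ℝ} (x k : ℝ) (hT : 0 < T) (hσ : 0 < σ) :
    HasDerivAt (fun t => Bac t x k σ) (σ * (1 / (2 * √T)) * normalPDF (dBac T x k σ)) T := by
  have h := hasDerivAt_mul_normalCDF_add_mul_normalPDF (hasDerivAt_const T (x - k))
    ((Real.hasDerivAt_sqrt hT.ne').const_mul σ) (by positivity)
  exact h.congr_deriv (by simp [dBac])

lemma hasDerivAt_Bac_spot {T σ : ℝ} (x k : ℝ) (hT : 0 < T) (hσ : 0 < σ) :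
    HasDerivAt (fun y => Bac T y k σ) (normalCDF (dBac T x k σ)) x := by
  have h := hasDerivAt_mul_normalCDF_add_mul_normalPDF ((hasDerivAt_id x).sub_const k)
    (hasDerivAt_const x (σ * √T)) (by positivity)
  exact h.congr_deriv (by simp [dBac])

/-- The Bachelier price solves the Bachelier heat equation in the
time-to-maturity variable: `∂Bac/∂T = (1/2) σ² ∂²Bac/∂x²`. -/
theorem bachelier_heat_equation (T σ x k : ℝ) (hT : 0 < T) (hσ : 0 < σ) :
    deriv (fun t => Bac t x k σ) T
      = (1 / 2) * σ ^ 2 * deriv (deriv (fun y => Bac T y k σ)) x := by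
  have hdelta : deriv (fun y => Bac T y k σ) = fun y => normalCDF (dBac T y k σ) :=
    funext fun y => (hasDerivAt_Bac_spot y k hT hσ).deriv
  have hd : HasDerivAt (fun y => dBac T y k σ) (1 / (σ * √T)) x :=
    ((hasDerivAt_id x).sub_const k).div_const _
  have hgamma : HasDerivAt (fun y => normalCDF (dBac T y k σ))
      (normalPDF (dBac T x k σ) * (1 / (σ * √T))) x :=
    (hasDerivAt_normalCDF _).comp x hd
  rw [(hasDerivAt_Bac_time x k hT hσ).deriv, hdelta, hgamma.deriv]
  field_simp
end

section
/- For every T > 0, σ > 0 and x, k ∈ ℝ, the Bachelier price admits the absolutely convergent analytic expansion Bac(T,x,k,σ) = (x − k)/2 + σ√T/√(2π) − (√T/√(2π)) · Σ_{n=1}^∞ [1/(n!·(2n−1))] · (−(x − k)²/(2T))ⁿ · σ^{1−2n}. -/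
open MeasureTheory ProbabilityTheory Real NNReal

theorem hasSum_exp_div_factorial (x : ℝ) :
    HasSum (fun n : ℕ => x ^ n / (Nat.factorial n : ℝ)) (Real.exp x) := by
  rw [Real.exp_eq_exp_ℝ]
  exact NormedSpace.expSeries_div_hasSum_exp x

theorem hasSum_integral_exp_neg_sq_div_two (d : ℝ) :
    HasSum (fun n : ℕ => (-1 / 2) ^ n * d ^ (2 * n + 1) / ((Nat.factorial n : ℝ) * (2 * n + 1)))
      (∫ t in (0 : ℝ)..d, Real.exp (-t ^ 2 / 2)) := by
  have hbound : ∀ (n : ℕ) (t : ℝ), t ∈ Set.uIoc 0 d →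
      ‖(-t ^ 2 / 2) ^ n / (Nat.factorial n : ℝ)‖ ≤ (d ^ 2 / 2) ^ n / (Nat.factorial n : ℝ) := by
    intro n t ht
    have habs : |t| ≤ |d| := by
      simpa using Set.abs_sub_left_of_mem_uIcc (Set.uIoc_subset_uIcc ht)
    have hsq : t ^ 2 ≤ d ^ 2 := sq_le_sq.mpr habs
    rw [norm_div, norm_pow, Real.norm_natCast, neg_div, norm_neg,
      Real.norm_of_nonneg (by positivity)]
    gcongr
  have key : HasSum (fun n : ℕ => ∫ t in (0 : ℝ)..d, (-t ^ 2 / 2) ^ n / (Nat.factorial n : ℝ))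
      (∫ t in (0 : ℝ)..d, Real.exp (-t ^ 2 / 2)) :=
    intervalIntegral.hasSum_integral_of_dominated_convergence
      (fun n _ => (d ^ 2 / 2) ^ n / (Nat.factorial n : ℝ))
      (fun n => (by fun_prop : Continuous fun t : ℝ =>
        (-t ^ 2 / 2) ^ n / (Nat.factorial n : ℝ)).aestronglyMeasurable)
      (fun n => ae_of_all _ (hbound n))
      (ae_of_all _ fun _ _ => Real.summable_pow_div_factorial _)
      intervalIntegrable_const
      (ae_of_all _ fun _ _ => hasSum_exp_div_factorial _)
  convert key using 2 with n
  have hterm : ∀ t : ℝ, (-t ^ 2 / 2) ^ n / (Nat.factorial n : ℝ)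
      = (-1 / 2) ^ n / (Nat.factorial n : ℝ) * t ^ (2 * n) := fun t => by
    rw [show -t ^ 2 / 2 = (-1 / 2) * t ^ 2 by ring, mul_pow, ← pow_mul]
    ring
  simp_rw [hterm]
  rw [intervalIntegral.integral_const_mul, integral_pow]
  push_cast
  field_simp
  simp

theorem integrable_exp_neg_sq_div_two :
    Integrable fun t : ℝ => Real.exp (-t ^ 2 / 2) := by
  convert integrable_exp_neg_mul_sq (b := 1 / 2) (by norm_num) using 3
  ring

theorem integral_Iic_zero_exp_neg_sq_div_two :
    ∫ t in Set.Iic (0 : ℝ), Real.exp (-t ^ 2 / 2) = Real.sqrt (2 * Real.pi) / 2 := by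
  have h := integral_comp_neg_Iic (0 : ℝ) fun t => Real.exp (-(1 / 2) * t ^ 2)
  rw [neg_zero, integral_gaussian_Ioi] at h
  convert h using 2
  · ext t
    ring_nf
  · congr 1
    ring

theorem normalCDF_eq (d : ℝ) :
    normalCDF d = 1 / 2 + (∫ t in (0 : ℝ)..d, Real.exp (-t ^ 2 / 2)) / Real.sqrt (2 * Real.pi) := by
  have h := intervalIntegral.integral_Iic_sub_Iic
    (integrable_exp_neg_sq_div_two.integrableOn (s := Set.Iic 0))
    (integrable_exp_neg_sq_div_two.integrableOn (s := Set.Iic d))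
  rw [normalCDF, integral_div, ← h, integral_Iic_zero_exp_neg_sq_div_two]
  field_simp
  ring

theorem hasSum_mul_integral_add_exp (d : ℝ) :
    HasSum (fun n : ℕ => 1 / ((Nat.factorial (n + 1) : ℝ) * (2 * ((n : ℝ) + 1) - 1)) *
        (-d ^ 2 / 2) ^ (n + 1))
      (1 - (d * (∫ t in (0 : ℝ)..d, Real.exp (-t ^ 2 / 2)) + Real.exp (-d ^ 2 / 2))) := by
  have hexp : HasSum (fun n : ℕ => (-d ^ 2 / 2) ^ (n + 1) / (Nat.factorial (n + 1) : ℝ))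
      (Real.exp (-d ^ 2 / 2) - 1) := by
    simpa using (hasSum_nat_add_iff' 1).mpr (hasSum_exp_div_factorial (-d ^ 2 / 2))
  have hneg := (((hasSum_integral_exp_neg_sq_div_two d).mul_left d).add hexp).neg
  have hlim : ∀ a b : ℝ, 1 - (a + b) = -(a + (b - 1)) := fun a b => by ring
  rw [hlim]
  convert! hneg using 2 with n
  have hpow : (-1 / 2 : ℝ) ^ n * d ^ (2 * n + 1) = d * (-d ^ 2 / 2) ^ n := by
    rw [show -d ^ 2 / 2 = (-1 / 2) * d ^ 2 by ring, mul_pow]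
    ring
  rw [hpow, Nat.factorial_succ, pow_succ, show 2 * ((n : ℝ) + 1) - 1 = 2 * n + 1 by ring]
  push_cast
  field_simp
  ring

/-- Analytic expansion of the Bachelier price in powers of the moneyness:
`Bac = (x−k)/2 + σ√T/√(2π) − (√T/√(2π)) Σ_{n≥1} [1/(n!(2n−1))] (−(x−k)²/(2T))ⁿ σ^{1−2n}`,
the series (indexed below by `n+1`, `n : ℕ`) converging absolutely. -/
theorem bachelier_price_series (T σ x k : ℝ) (hT : 0 < T) (hσ : 0 < σ) :
    (Summable fun n : ℕ =>
      |1 / ((Nat.factorial (n + 1) : ℝ) * (2 * ((n : ℝ) + 1) - 1)) *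
        (-(x - k) ^ 2 / (2 * T)) ^ (n + 1) * σ ^ (1 - 2 * ((n : ℤ) + 1))|) ∧
    Bac T x k σ
      = (x - k) / 2 + σ * Real.sqrt T / Real.sqrt (2 * Real.pi)
        - Real.sqrt T / Real.sqrt (2 * Real.pi) *
          ∑' n : ℕ, 1 / ((Nat.factorial (n + 1) : ℝ) * (2 * ((n : ℝ) + 1) - 1)) *
            (-(x - k) ^ 2 / (2 * T)) ^ (n + 1) * σ ^ (1 - 2 * ((n : ℤ) + 1)) := by
  have hsum := (hasSum_mul_integral_add_exp (dBac T x k σ)).mul_left σ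
  have hterm : ∀ n : ℕ, σ * (1 / ((Nat.factorial (n + 1) : ℝ) * (2 * ((n : ℝ) + 1) - 1)) *
      (-dBac T x k σ ^ 2 / 2) ^ (n + 1))
      = 1 / ((Nat.factorial (n + 1) : ℝ) * (2 * ((n : ℝ) + 1) - 1)) *
        (-(x - k) ^ 2 / (2 * T)) ^ (n + 1) * σ ^ (1 - 2 * ((n : ℤ) + 1)) := fun n => by
    have hz : σ ^ (1 - 2 * ((n : ℤ) + 1)) = σ * ((σ ^ 2)⁻¹) ^ (n + 1) := by
      rw [zpow_sub₀ hσ.ne', zpow_one, zpow_mul, inv_pow, div_eq_mul_inv]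
      norm_cast
    have hd : -dBac T x k σ ^ 2 / 2 = -(x - k) ^ 2 / (2 * T) * (σ ^ 2)⁻¹ := by
      rw [dBac, div_pow, mul_pow, Real.sq_sqrt hT.le]
      field_simp
    rw [hz, hd, mul_pow]
    ring
  simp only [hterm] at hsum
  refine ⟨hsum.summable.abs, ?_⟩
  have hxk : x - k = σ * Real.sqrt T * dBac T x k σ := by
    rw [dBac]
    field_simp
  rw [hsum.tsum_eq, Bac, normalCDF_eq, normalPDF, hxk]
  field_simp
  ring
end

section
/- (Gamma expansion, mixed form.) Let T > 0, k ∈ ℝ, and let W be a random variable with W > 0 almost surely, E[W] < ∞, and E[W^{1/2}·exp(c/W)] < ∞ for every c > 0. Then the function x ↦ E[Bac(T, x, k, √W)] is twice differentiable on ℝ and its second derivative (the option's Gamma) equals Γ(x) = (1/(√(2πT)·v)) · exp(−(x − k)²/(2 v² T)) + (1/√(2πT)) · Σ_{n=1}^∞ [1/(n−1)!] · (−(x − k)²/(2T))^{n−1} · ( E[W^{1/2−n}] − v^{1−2n} ), where v = √(E[W]) and the series converges absolutely. -/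
open MeasureTheory ProbabilityTheory Real NNReal

lemma integrable_normalPDF_s13 :
    Integrable fun t : ℝ => Real.exp (-t ^ 2 / 2) / Real.sqrt (2 * Real.pi) := by
  refine Integrable.div_const ?_ _
  convert integrable_exp_neg_mul_sq (b := 1 / 2) (by norm_num) using 3
  ring

lemma continuous_normalCDF : Continuous normalCDF :=
  continuous_iff_continuousAt.2 fun z => (hasDerivAt_normalCDF z).continuousAt

lemma normalPDF_nonneg (z : ℝ) : 0 ≤ normalPDF z := by
  unfold normalPDF
  positivity

lemma normalPDF_le_one (z : ℝ) : normalPDF z ≤ 1 := by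
  unfold normalPDF
  have h1 : Real.exp (-z ^ 2 / 2) ≤ 1 := Real.exp_le_one_iff.2 (by nlinarith [sq_nonneg z])
  have h2 : (1 : ℝ) ≤ Real.sqrt (2 * Real.pi) :=
    Real.one_le_sqrt.2 (by nlinarith [Real.pi_gt_three])
  rw [div_le_one (by linarith)]
  linarith

lemma exists_abs_normalCDF_le : ∃ C : ℝ, ∀ z, |normalCDF z| ≤ C := by
  refine ⟨∫ t : ℝ, normalPDF t, fun z => ?_⟩
  have h0 : 0 ≤ normalCDF z := integral_nonneg fun t => normalPDF_nonneg t
  rw [abs_of_nonneg h0]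
  exact setIntegral_le_integral integrable_normalPDF_s13
    (Filter.Eventually.of_forall fun t => normalPDF_nonneg t)

lemma hasDerivAt_dBac (T x k σ : ℝ) :
    HasDerivAt (fun y => dBac T y k σ) (1 / (σ * Real.sqrt T)) x :=
  ((hasDerivAt_id x).sub_const k).div_const _

/-- The Delta of a Bachelier call. -/
lemma hasDerivAt_Bac {T σ : ℝ} (hT : 0 < T) (hσ : 0 < σ) (x k : ℝ) :
    HasDerivAt (fun y => Bac T y k σ) (normalCDF (dBac T x k σ)) x := by
  have hd := hasDerivAt_dBac T x k σ
  have hN := (hasDerivAt_normalCDF (dBac T x k σ)).comp x hd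
  have hp := (hasDerivAt_normalPDF (dBac T x k σ)).comp x hd
  have hsT := Real.sqrt_pos.2 hT
  convert! (((hasDerivAt_id x).sub_const k).mul hN).add (hp.const_mul (σ * Real.sqrt T)) using 1
  simp only [dBac, id, Function.comp]
  field_simp
  ring

/-- The Gamma of a Bachelier call. -/
lemma hasDerivAt_normalCDF_dBac (T x k σ : ℝ) :
    HasDerivAt (fun y => normalCDF (dBac T y k σ))
      (normalPDF (dBac T x k σ) * (1 / (σ * Real.sqrt T))) x :=
  HasDerivAt.comp x (h₂ := normalCDF) (hasDerivAt_normalCDF _) (hasDerivAt_dBac T x k σ)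

lemma normalPDF_dBac_sqrt {T w : ℝ} (hT : 0 < T) (hw : 0 < w) (x k : ℝ) :
    normalPDF (dBac T x k (Real.sqrt w)) * (1 / (Real.sqrt w * Real.sqrt T)) =
      1 / Real.sqrt (2 * Real.pi * T) *
        ((Real.sqrt w)⁻¹ * Real.exp (-(x - k) ^ 2 / (2 * T) / w)) := by
  have hsw := Real.sqrt_pos.2 hw
  have hsT := Real.sqrt_pos.2 hT
  have hexponent : -(dBac T x k (Real.sqrt w)) ^ 2 / 2 = -(x - k) ^ 2 / (2 * T) / w := by
    rw [dBac, div_pow, mul_pow, Real.sq_sqrt hw.le, Real.sq_sqrt hT.le]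
    field_simp
  rw [normalPDF, hexponent, Real.sqrt_mul (by positivity : 0 ≤ 2 * Real.pi)]
  field_simp

lemma hasSum_exp_div (b y : ℝ) :
    HasSum (fun n : ℕ => 1 / (Nat.factorial n : ℝ) * b ^ n * (y⁻¹) ^ n) (Real.exp (b / y)) := by
  have h := NormedSpace.expSeries_div_hasSum_exp (b / y)
  rw [← Real.exp_eq_exp_ℝ] at h
  refine h.congr_fun fun n => ?_
  rw [div_eq_mul_inv b y, mul_pow]
  ring

lemma hasSum_exp_div_rpow (b : ℝ) {w : ℝ} (hw : 0 < w) :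
    HasSum (fun n : ℕ => 1 / (Nat.factorial n : ℝ) * b ^ n * w ^ ((1 : ℝ) / 2 - ((n : ℝ) + 1)))
      ((Real.sqrt w)⁻¹ * Real.exp (b / w)) := by
  refine ((hasSum_exp_div b w).mul_left (Real.sqrt w)⁻¹).congr_fun fun n => ?_
  have h : w ^ ((1 : ℝ) / 2 - ((n : ℝ) + 1)) = (Real.sqrt w)⁻¹ * (w⁻¹) ^ n := by
    rw [show (1 : ℝ) / 2 - ((n : ℝ) + 1) = -(1 / 2) + -(n : ℝ) by ring, Real.rpow_add hw,
      Real.rpow_neg hw.le, Real.rpow_neg hw.le, Real.rpow_natCast, ← Real.sqrt_eq_rpow, inv_pow]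
  rw [h]
  ring

lemma hasSum_exp_div_zpow (b : ℝ) {v : ℝ} (hv : 0 < v) :
    HasSum (fun n : ℕ => 1 / (Nat.factorial n : ℝ) * b ^ n * v ^ (1 - 2 * ((n : ℤ) + 1)))
      (v⁻¹ * Real.exp (b / v ^ 2)) := by
  refine ((hasSum_exp_div b (v ^ 2)).mul_left v⁻¹).congr_fun fun n => ?_
  have h : v ^ (1 - 2 * ((n : ℤ) + 1)) = v⁻¹ * ((v ^ 2)⁻¹) ^ n := by
    rw [show 1 - 2 * ((n : ℤ) + 1) = -1 + -((2 * n : ℕ) : ℤ) by push_cast; ring,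
      zpow_add₀ hv.ne', zpow_neg_one, zpow_neg, zpow_natCast, pow_mul, inv_pow]
  rw [h]
  ring

section

variable {Ω : Type*} [MeasurableSpace Ω] {P : Measure Ω} {W : Ω → ℝ}

lemma integrable_inv_sqrt_mul_exp (hW : Measurable W) (hpos : ∀ᵐ ω ∂P, 0 < W ω)
    (hexp : ∀ c : ℝ, 0 < c →
      Integrable (fun ω => W ω ^ ((1 : ℝ) / 2) * Real.exp (c / W ω)) P)
    {b : ℝ} (hb : 0 ≤ b) :
    Integrable (fun ω => (Real.sqrt (W ω))⁻¹ * Real.exp (b / W ω)) P := by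
  refine (hexp (b + 1) (by linarith)).mono' (by fun_prop) ?_
  filter_upwards [hpos] with ω hω
  have hs := Real.sqrt_pos.2 hω
  rw [Real.norm_of_nonneg (by positivity), ← Real.sqrt_eq_rpow, add_div, Real.exp_add]
  have h1 : 1 / W ω ≤ Real.exp (1 / W ω) := by
    linarith [Real.add_one_le_exp (1 / W ω)]
  have h2 : (Real.sqrt (W ω))⁻¹ = Real.sqrt (W ω) * (1 / W ω) := by
    have := Real.sq_sqrt hω.le
    field_simp
    linarith
  rw [h2]
  calc Real.sqrt (W ω) * (1 / W ω) * Real.exp (b / W ω)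
      ≤ Real.sqrt (W ω) * Real.exp (1 / W ω) * Real.exp (b / W ω) := by gcongr
    _ = _ := by ring

lemma hasSum_integral_exp_div (hW : Measurable W) (hpos : ∀ᵐ ω ∂P, 0 < W ω)
    (hexp : ∀ c : ℝ, 0 < c →
      Integrable (fun ω => W ω ^ ((1 : ℝ) / 2) * Real.exp (c / W ω)) P) (b : ℝ) :
    HasSum (fun n : ℕ => 1 / (Nat.factorial n : ℝ) * b ^ n *
        ∫ ω, W ω ^ ((1 : ℝ) / 2 - ((n : ℝ) + 1)) ∂P)
      (∫ ω, (Real.sqrt (W ω))⁻¹ * Real.exp (b / W ω) ∂P) := by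
  simp_rw [← integral_const_mul]
  refine hasSum_integral_of_dominated_convergence
    (fun (n : ℕ) ω => 1 / (Nat.factorial n : ℝ) * |b| ^ n *
      W ω ^ ((1 : ℝ) / 2 - ((n : ℝ) + 1))) (fun n => ?_) (fun n => ?_) ?_ ?_ ?_
  · exact ((hW.pow_const _).const_mul _).aestronglyMeasurable
  · filter_upwards [hpos] with ω hω
    rw [norm_mul, norm_mul, norm_pow, Real.norm_of_nonneg (by positivity : (0 : ℝ) ≤ 1 / _),
      Real.norm_of_nonneg (Real.rpow_nonneg hω.le _), Real.norm_eq_abs]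
  · filter_upwards [hpos] with ω hω using (hasSum_exp_div_rpow |b| hω).summable
  · refine (integrable_inv_sqrt_mul_exp hW hpos hexp (abs_nonneg b)).congr ?_
    filter_upwards [hpos] with ω hω using (hasSum_exp_div_rpow |b| hω).tsum_eq.symm
  · filter_upwards [hpos] with ω hω using hasSum_exp_div_rpow b hω

lemma measurable_dBac_sqrt (hW : Measurable W) (T x k : ℝ) :
    Measurable fun ω => dBac T x k (Real.sqrt (W ω)) := by
  unfold dBac
  fun_prop

lemma measurable_Bac_sqrt (hW : Measurable W) (T x k : ℝ) :
    Measurable fun ω => Bac T x k (Real.sqrt (W ω)) := by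
  have hd := measurable_dBac_sqrt hW T x k
  have hN := continuous_normalCDF.measurable.comp hd
  have hp := continuous_normalPDF.measurable.comp hd
  exact (hN.const_mul (x - k)).add ((hW.sqrt.mul_const (Real.sqrt T)).mul hp)

lemma integrable_Bac_sqrt [IsFiniteMeasure P] (hW : Measurable W) (hpos : ∀ᵐ ω ∂P, 0 < W ω)
    (hWint : Integrable W P) (T x k : ℝ) :
    Integrable (fun ω => Bac T x k (Real.sqrt (W ω))) P := by
  obtain ⟨C, hC⟩ := exists_abs_normalCDF_le
  refine Integrable.mono' (g := fun ω => |x - k| * C + (1 + W ω) * Real.sqrt T)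
    ((integrable_const _).add (((integrable_const _).add hWint).mul_const _))
    (measurable_Bac_sqrt hW T x k).aestronglyMeasurable ?_
  filter_upwards [hpos] with ω hω
  have hs : Real.sqrt (W ω) ≤ 1 + W ω := by
    nlinarith [Real.sq_sqrt hω.le, sq_nonneg (Real.sqrt (W ω) - 1), Real.sqrt_nonneg (W ω)]
  rw [Bac, Real.norm_eq_abs]
  refine (abs_add_le _ _).trans (add_le_add ?_ ?_)
  · rw [abs_mul]
    exact mul_le_mul_of_nonneg_left (hC _) (abs_nonneg _)
  · rw [abs_of_nonneg (mul_nonneg (by positivity) (normalPDF_nonneg _))]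
    calc Real.sqrt (W ω) * Real.sqrt T * normalPDF (dBac T x k (Real.sqrt (W ω)))
        ≤ Real.sqrt (W ω) * Real.sqrt T * 1 := by
          gcongr
          exact normalPDF_le_one _
      _ ≤ (1 + W ω) * Real.sqrt T := by
          rw [mul_one]
          gcongr

/-- The Delta of a mixture of Bachelier calls is the mixture of the Deltas. -/
lemma hasDerivAt_integral_Bac_sqrt [IsFiniteMeasure P] (hW : Measurable W)
    (hpos : ∀ᵐ ω ∂P, 0 < W ω) (hWint : Integrable W P) {T : ℝ} (hT : 0 < T) (x k : ℝ) :
    Integrable (fun ω => normalCDF (dBac T x k (Real.sqrt (W ω)))) P ∧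
    HasDerivAt (fun y => ∫ ω, Bac T y k (Real.sqrt (W ω)) ∂P)
      (∫ ω, normalCDF (dBac T x k (Real.sqrt (W ω))) ∂P) x := by
  obtain ⟨C, hC⟩ := exists_abs_normalCDF_le
  refine hasDerivAt_integral_of_dominated_loc_of_deriv_le (bound := fun _ => C)
    (F := fun y ω => Bac T y k (Real.sqrt (W ω)))
    (F' := fun y ω => normalCDF (dBac T y k (Real.sqrt (W ω)))) Filter.univ_mem
    (Filter.Eventually.of_forall fun y => (measurable_Bac_sqrt hW T y k).aestronglyMeasurable)
    (integrable_Bac_sqrt hW hpos hWint T x k)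
    (continuous_normalCDF.measurable.comp (measurable_dBac_sqrt hW T x k)).aestronglyMeasurable
    (Filter.Eventually.of_forall fun ω y _ => hC _) (integrable_const _) ?_
  filter_upwards [hpos] with ω hω y _ using hasDerivAt_Bac hT (Real.sqrt_pos.2 hω) y k

/-- The Gamma of a mixture of Bachelier calls is the mixture of the Gammas. -/
lemma hasDerivAt_integral_normalCDF_dBac_sqrt (hW : Measurable W) {T x k : ℝ}
    (hinv : Integrable (fun ω => (Real.sqrt (W ω))⁻¹) P)
    (hint : Integrable (fun ω => normalCDF (dBac T x k (Real.sqrt (W ω)))) P) :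
    HasDerivAt (fun y => ∫ ω, normalCDF (dBac T y k (Real.sqrt (W ω))) ∂P)
      (∫ ω, normalPDF (dBac T x k (Real.sqrt (W ω))) *
        (1 / (Real.sqrt (W ω) * Real.sqrt T)) ∂P) x := by
  refine (hasDerivAt_integral_of_dominated_loc_of_deriv_le
    (bound := fun ω => (Real.sqrt (W ω))⁻¹ * (Real.sqrt T)⁻¹)
    (F := fun y ω => normalCDF (dBac T y k (Real.sqrt (W ω))))
    (F' := fun y ω => normalPDF (dBac T y k (Real.sqrt (W ω))) *
        (1 / (Real.sqrt (W ω) * Real.sqrt T))) Filter.univ_mem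
    (Filter.Eventually.of_forall fun y => (continuous_normalCDF.measurable.comp
      (measurable_dBac_sqrt hW T y k)).aestronglyMeasurable)
    hint
    ((continuous_normalPDF.measurable.comp (measurable_dBac_sqrt hW T x k)).mul
      (by fun_prop)).aestronglyMeasurable
    (Filter.Eventually.of_forall fun ω y _ => ?_) (hinv.mul_const _)
    (Filter.Eventually.of_forall fun ω y _ => hasDerivAt_normalCDF_dBac T y k _)).2
  rw [Real.norm_of_nonneg (mul_nonneg (normalPDF_nonneg _) (by positivity)), one_div, mul_inv]
  exact mul_le_of_le_one_left (by positivity) (normalPDF_le_one _)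

end

/-- Gamma expansion (mixed form): `x ↦ E[Bac(T,x,k,√W)]` is twice differentiable
and its second derivative equals
`Γ(x) = (1/(√(2πT)·v)) exp(−(x−k)²/(2v²T)) + (1/√(2πT)) Σ_{n≥1} [1/(n−1)!]
  (−(x−k)²/(2T))^{n−1} (E[W^{1/2−n}] − v^{1−2n})`, where `v = √E[W]`;
the series (indexed below by `n+1`) converges absolutely. -/
theorem bachelier_gamma_expansion_mixed
    {Ω : Type*} [MeasurableSpace Ω] (P : Measure Ω) [IsProbabilityMeasure P]
    (T k : ℝ) (hT : 0 < T)
    (W : Ω → ℝ) (hW : Measurable W) (hpos : ∀ᵐ ω ∂P, 0 < W ω)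
    (hWint : Integrable W P)
    (hexp : ∀ c : ℝ, 0 < c →
      Integrable (fun ω => W ω ^ ((1 : ℝ) / 2) * Real.exp (c / W ω)) P) :
    (∀ x : ℝ, DifferentiableAt ℝ (fun y => ∫ ω, Bac T y k (Real.sqrt (W ω)) ∂P) x) ∧
    (∀ x : ℝ,
      DifferentiableAt ℝ (deriv (fun y => ∫ ω, Bac T y k (Real.sqrt (W ω)) ∂P)) x) ∧
    ∀ x : ℝ,
      (Summable fun n : ℕ =>
        |1 / (Nat.factorial n : ℝ) * (-(x - k) ^ 2 / (2 * T)) ^ n *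
          ((∫ ω, W ω ^ ((1 : ℝ) / 2 - ((n : ℝ) + 1)) ∂P)
            - Real.sqrt (∫ ω, W ω ∂P) ^ (1 - 2 * ((n : ℤ) + 1)))|) ∧
      deriv (deriv (fun y => ∫ ω, Bac T y k (Real.sqrt (W ω)) ∂P)) x
        = 1 / (Real.sqrt (2 * Real.pi * T) * Real.sqrt (∫ ω, W ω ∂P)) *
            Real.exp (-(x - k) ^ 2 /
              (2 * Real.sqrt (∫ ω, W ω ∂P) ^ 2 * T))
          + 1 / Real.sqrt (2 * Real.pi * T) *
            ∑' n : ℕ, 1 / (Nat.factorial n : ℝ) * (-(x - k) ^ 2 / (2 * T)) ^ n *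
              ((∫ ω, W ω ^ ((1 : ℝ) / 2 - ((n : ℝ) + 1)) ∂P)
                - Real.sqrt (∫ ω, W ω ∂P) ^ (1 - 2 * ((n : ℤ) + 1))) := by
  have hdelta := fun x => hasDerivAt_integral_Bac_sqrt hW hpos hWint hT x k
  have hinv : Integrable (fun ω => (Real.sqrt (W ω))⁻¹) P := by
    simpa using integrable_inv_sqrt_mul_exp hW hpos hexp le_rfl
  have hderiv : deriv (fun y => ∫ ω, Bac T y k (Real.sqrt (W ω)) ∂P) =
      fun y => ∫ ω, normalCDF (dBac T y k (Real.sqrt (W ω))) ∂P :=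
    funext fun x => (hdelta x).2.deriv
  have hgamma := fun x => hasDerivAt_integral_normalCDF_dBac_sqrt hW hinv (hdelta x).1
  have hmean : 0 < ∫ ω, W ω ∂P := by
    rw [integral_pos_iff_support_of_nonneg_ae (hpos.mono fun ω hω => hω.le) hWint]
    have hsupp : ∀ᵐ ω ∂P, ω ∈ Function.support W := hpos.mono fun ω hω => hω.ne'
    have huniv : Function.support W =ᵐ[P] Set.univ := Filter.eventuallyEq_univ.2 hsupp
    rw [measure_congr huniv, measure_univ]
    exact one_pos
  refine ⟨fun x => (hdelta x).2.differentiableAt, fun x => ?_, fun x => ?_⟩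
  · rw [hderiv]
    exact (hgamma x).differentiableAt
  · have hv := Real.sqrt_pos.2 hmean
    set v := Real.sqrt (∫ ω, W ω ∂P)
    have hsum := (hasSum_integral_exp_div hW hpos hexp (-(x - k) ^ 2 / (2 * T))).sub
      (hasSum_exp_div_zpow (-(x - k) ^ 2 / (2 * T)) hv)
    simp_rw [← mul_sub] at hsum
    refine ⟨hsum.summable.abs, ?_⟩
    have hint : ∫ ω, normalPDF (dBac T x k (Real.sqrt (W ω))) *
          (1 / (Real.sqrt (W ω) * Real.sqrt T)) ∂P =
        1 / Real.sqrt (2 * Real.pi * T) *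
          ∫ ω, (Real.sqrt (W ω))⁻¹ * Real.exp (-(x - k) ^ 2 / (2 * T) / W ω) ∂P := by
      rw [← integral_const_mul]
      refine integral_congr_ae ?_
      filter_upwards [hpos] with ω hω using normalPDF_dBac_sqrt hT hω x k
    have hexponent : -(x - k) ^ 2 / (2 * v ^ 2 * T) = -(x - k) ^ 2 / (2 * T) / v ^ 2 := by
      field_simp
    rw [hderiv, (hgamma x).deriv, hsum.tsum_eq, hint, hexponent, one_div_mul_eq_div, one_div,
      mul_inv]
    ring
end
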